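/- arXiv:1607.06143 — 2 statements merged into one kernel-verified Lean document; each statement's English description precedes it below -/
import Mathlib

section
/- Let c = (c_1, …, c_N) be a random vector in F_q^N whose entries are i.i.d. with distribution μ, and let x ∈ F_q^N be a fixed vector with exactly w ≥ 1 nonzero coordinates. Then the probability that the inner product c·x = Σ_{j=1}^N c_j x_j equals 0 is γ_w = q^{-1} + (1 − q^{-1})·(1 − (1−ε_SR)/(1−q^{-1}))^w. -/
open Finset
open scoped Classical

noncomputable section

/-- The entry distribution μ on the finite field `F`: the value `0` has
probability `ε_SR` and each nonzero value has probability `(1-ε_SR)/(q-1)`,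
where `q = |F|`. -/
def muDist (F : Type*) [Field F] [Fintype F] [DecidableEq F] (εSR : ℝ) (t : F) : ℝ :=
  if t = 0 then εSR else (1 - εSR) / ((Fintype.card F : ℝ) - 1)

/-- The probability that a random vector in `F^m` with i.i.d. `μ`-distributed
entries equals the fixed vector `v`. -/
def vecProb (F : Type*) [Field F] [Fintype F] [DecidableEq F] (εSR : ℝ) {m : ℕ}
    (v : Fin m → F) : ℝ :=
  ∏ j, muDist F εSR (v j)

/-- `γ_w = q⁻¹ + (1 - q⁻¹)·(1 - (1-ε_SR)/(1-q⁻¹))^w`. -/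
def gammaW (q εSR : ℝ) (w : ℕ) : ℝ :=
  q⁻¹ + (1 - q⁻¹) * (1 - (1 - εSR) / (1 - q⁻¹)) ^ w

/-- The bias `ρ = 1 - (1-ε_SR)/(1-q⁻¹)`: the distribution `μ` is the mixture of the uniform
distribution with weight `1 - ρ` and the point mass at `0` with weight `ρ`. -/
def muBias (q εSR : ℝ) : ℝ :=
  1 - (1 - εSR) / (1 - q⁻¹)

theorem muDist_eq_mixture (F : Type*) [Field F] [Fintype F] [DecidableEq F] (εSR : ℝ) (t : F) :
    muDist F εSR t = (1 - muBias (Fintype.card F) εSR) / (Fintype.card F : ℝ) +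
      if t = 0 then muBias (Fintype.card F) εSR else 0 := by
  have hq : (1 : ℝ) < Fintype.card F := by exact_mod_cast Fintype.one_lt_card
  have h0 : (Fintype.card F : ℝ) ≠ 0 := by positivity
  have h1 : (Fintype.card F : ℝ) - 1 ≠ 0 := by linarith
  have h2 : 1 - (Fintype.card F : ℝ)⁻¹ = ((Fintype.card F : ℝ) - 1) / Fintype.card F := by
    field_simp
  unfold muDist muBias
  rw [h2]
  split_ifs
  · field_simp
    ring
  · field_simp
    ring

theorem sum_muDist_mul (F : Type*) [Field F] [Fintype F] [DecidableEq F] (εSR : ℝ) (g : F → ℝ) :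
    ∑ a, muDist F εSR a * g a =
      (1 - muBias (Fintype.card F) εSR) / (Fintype.card F : ℝ) * ∑ a, g a +
        muBias (Fintype.card F) εSR * g 0 := by
  simp only [muDist_eq_mixture, add_mul, ite_mul, zero_mul, sum_add_distrib, ← mul_sum,
    sum_ite_eq', mem_univ, if_true]

theorem sum_muDist (F : Type*) [Field F] [Fintype F] [DecidableEq F] (εSR : ℝ) :
    ∑ a, muDist F εSR a = 1 := by
  have h := sum_muDist_mul F εSR fun _ => 1
  have h0 : (Fintype.card F : ℝ) ≠ 0 := by exact_mod_cast Fintype.card_ne_zero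
  simp only [mul_one, sum_const, card_univ, nsmul_eq_mul] at h
  rw [h]
  field_simp
  ring

/-- The distribution of the inner product of a `μ`-random vector with a fixed vector. -/
theorem sum_vecProb_inner_eq (F : Type*) [Field F] [Fintype F] [DecidableEq F] (εSR : ℝ)
    {N : ℕ} (x : Fin N → F) (s : F) :
    (∑ c : Fin N → F, if (∑ j, c j * x j) = s then vecProb F εSR c else 0) =
      (Fintype.card F : ℝ)⁻¹ + ((if s = 0 then 1 else 0) - (Fintype.card F : ℝ)⁻¹) *
        ∏ j, if x j ≠ 0 then muBias (Fintype.card F) εSR else 1 := by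
  have h0 : (Fintype.card F : ℝ) ≠ 0 := by exact_mod_cast Fintype.card_ne_zero
  induction N generalizing s with
  | zero => simp [vecProb, eq_comm]
  | succ N ih =>
    have hstep : (∑ c : Fin (N + 1) → F, if (∑ j, c j * x j) = s then vecProb F εSR c else 0) =
        ∑ a, muDist F εSR a * ∑ c : Fin N → F,
          if (∑ j, c j * x j.succ) = s - a * x 0 then vecProb F εSR c else 0 := by
      rw [← (Fin.consEquiv fun _ => F).sum_comp, Fintype.sum_prod_type]
      refine sum_congr rfl fun a _ => ?_
      rw [mul_sum]
      refine sum_congr rfl fun c _ => ?_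
      simp [Fin.consEquiv, Fin.sum_univ_succ, vecProb, Fin.prod_univ_succ, eq_sub_iff_add_eq']
    rw [hstep, Fin.prod_univ_succ]
    simp only [ih fun j => x j.succ]
    by_cases hx : x 0 = 0
    · simp [hx, ← sum_mul, sum_muDist]
    · have hroot (a : F) : s - a * x 0 = 0 ↔ a = s / x 0 := by
        rw [sub_eq_zero, eq_div_iff hx, eq_comm]
      rw [sum_muDist_mul]
      simp only [zero_mul, sub_zero, hroot, sum_add_distrib, ← sum_mul, sum_sub_distrib,
        sum_ite_eq', mem_univ, if_true, sum_const, card_univ, nsmul_eq_mul, mul_inv_cancel₀ h0,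
        sub_self, add_zero, ne_eq, hx, not_false_eq_true]
      field_simp
      ring

/-- if `c ∈ F_q^N` is a random vector with i.i.d. `μ`-distributed entries
and `x ∈ F_q^N` is a fixed vector with exactly `w ≥ 1` nonzero coordinates, then the
probability that the inner product `c·x = Σ_j c_j x_j` equals `0` is `γ_w`. -/
theorem stmt_2 (F : Type*) [Field F] [Fintype F] [DecidableEq F]
    (hq : 2 ≤ Fintype.card F)
    (εSR : ℝ) (hεSR : εSR ∈ Set.Icc (0 : ℝ) 1)
    (N : ℕ) (x : Fin N → F) (w : ℕ) (hw : 1 ≤ w)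
    (hx : (univ.filter fun j => x j ≠ 0).card = w) :
    (∑ c : Fin N → F, if (∑ j, c j * x j) = 0 then vecProb F εSR c else 0) =
      gammaW (Fintype.card F : ℝ) εSR w := by
  rw [sum_vecProb_inner_eq, prod_ite, prod_const, prod_const_one, hx]
  simp [gammaW, muBias]
end
end

section
/- Let A be a random M×N matrix over F_q whose M·N entries are i.i.d. with distribution μ. Then the probability that rank(A) < N is at most μ0(N,M) = (1/(q−1))·Σ_{w=1}^{N} C(N,w)·(q−1)^w·γ_w^M. -/
open Finset
open scoped Classical

noncomputable section

/-- The probability that a random `M × N` matrix over `F` with i.i.d.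
`μ`-distributed entries equals the fixed matrix `A`. -/
def matProb (F : Type*) [Field F] [Fintype F] [DecidableEq F] (εSR : ℝ) {M N : ℕ}
    (A : Matrix (Fin M) (Fin N) F) : ℝ :=
  ∏ i, ∏ j, muDist F εSR (A i j)

/-- `μ0(N,M) = (1/(q-1))·Σ_{w=1}^{N} C(N,w)·(q-1)^w·γ_w^M`. -/
def mu0 (q εSR : ℝ) (N M : ℕ) : ℝ :=
  (1 / (q - 1)) * ∑ w ∈ Icc 1 N, (N.choose w : ℝ) * (q - 1) ^ w * gammaW q εSR w ^ M

section RandomRow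

variable {F : Type*} [Field F] [Fintype F]

lemma card_field_pos : (0 : ℝ) < Fintype.card F :=
  Nat.cast_pos.2 Fintype.card_pos

lemma one_lt_card_field : (1 : ℝ) < Fintype.card F :=
  Nat.one_lt_cast.2 Fintype.one_lt_card

variable [DecidableEq F]

/-- `μ` is a mixture of the uniform distribution and the point mass at `0`. -/
lemma muDist_eq_uniform_add_dirac (ε : ℝ) (t : F) :
    muDist F ε t = (1 - ε) / (1 - (Fintype.card F : ℝ)⁻¹) * (Fintype.card F : ℝ)⁻¹ +
      (1 - (1 - ε) / (1 - (Fintype.card F : ℝ)⁻¹)) * (if t = 0 then 1 else 0) := by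
  have h0 := (card_field_pos (F := F)).ne'
  have h1 := (sub_pos.2 (one_lt_card_field (F := F))).ne'
  have h2 : 1 - (Fintype.card F : ℝ)⁻¹ ≠ 0 := by
    rw [show 1 - (Fintype.card F : ℝ)⁻¹ = (Fintype.card F - 1) / Fintype.card F by field_simp]
    exact div_ne_zero h1 h0
  unfold muDist
  split_ifs
  · field_simp
    ring
  · rw [mul_zero, add_zero]
    field_simp

lemma sum_muDist_mul_s6 (ε : ℝ) (g : F → ℝ) :
    ∑ t, muDist F ε t * g t =
      (1 - ε) / (1 - (Fintype.card F : ℝ)⁻¹) * (Fintype.card F : ℝ)⁻¹ * ∑ t, g t +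
      (1 - (1 - ε) / (1 - (Fintype.card F : ℝ)⁻¹)) * g 0 := by
  simp_rw [muDist_eq_uniform_add_dirac, add_mul, sum_add_distrib, ← mul_sum, mul_assoc,
    ← mul_sum]
  simp

/-- The distribution of the inner product of a random row with a fixed vector. -/
lemma sum_prod_muDist_of_dotProduct_eq (ε : ℝ) {n : ℕ} (x : Fin n → F) (c : F) :
    (∑ a : Fin n → F, if a ⬝ᵥ x = c then ∏ j, muDist F ε (a j) else 0) =
      (Fintype.card F : ℝ)⁻¹ + ((if c = 0 then 1 else 0) - (Fintype.card F : ℝ)⁻¹) *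
        (1 - (1 - ε) / (1 - (Fintype.card F : ℝ)⁻¹)) ^ #{j | x j ≠ 0} := by
  have h0 := (card_field_pos (F := F)).ne'
  induction n generalizing c with
  | zero => simp [eq_comm]
  | succ n ih =>
    rw [← (Fin.consEquiv fun _ => F).sum_comp, Fintype.sum_prod_type]
    have hstep (t : F) : (∑ a : Fin n → F,
        if (Fin.consEquiv fun _ => F) (t, a) ⬝ᵥ x = c then
          ∏ j, muDist F ε ((Fin.consEquiv fun _ => F) (t, a) j) else 0) =
        muDist F ε t * ((Fintype.card F : ℝ)⁻¹ +
          ((if c - t * x 0 = 0 then 1 else 0) - (Fintype.card F : ℝ)⁻¹) *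
          (1 - (1 - ε) / (1 - (Fintype.card F : ℝ)⁻¹)) ^ #{j | Fin.tail x j ≠ 0}) := by
      rw [← ih, mul_sum]
      refine sum_congr rfl fun a _ => ?_
      have : (Fin.consEquiv fun _ => F) (t, a) ⬝ᵥ x = c ↔ a ⬝ᵥ Fin.tail x = c - t * x 0 := by
        simp [dotProduct, Fin.sum_univ_succ, Fin.consEquiv, Fin.tail, eq_sub_iff_add_eq, add_comm]
      simp only [this, mul_ite, mul_zero]
      simp [Fin.prod_univ_succ, Fin.consEquiv]
    simp_rw [hstep]
    rw [sum_muDist_mul_s6]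
    have hcard : #{j | x j ≠ 0} = (if x 0 = 0 then 0 else 1) + #{j | Fin.tail x j ≠ 0} := by
      rw [Fin.card_filter_univ_succ]
      by_cases hx : x 0 = 0 <;> simp [hx, Fin.tail, add_comm] <;> congr
    rw [hcard]
    by_cases hx : x 0 = 0
    · simp only [hx, mul_zero, sub_zero, sum_const, card_univ, nsmul_eq_mul, if_true, zero_add]
      field_simp
      ring
    · have hroot (t : F) : c - t * x 0 = 0 ↔ t = c / x 0 := by
        rw [sub_eq_zero, eq_div_iff hx, eq_comm]
      have hsum : ∑ t : F, ((if c - t * x 0 = 0 then (1 : ℝ) else 0) -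
          (Fintype.card F : ℝ)⁻¹) = 0 := by
        simp [hroot, h0]
      rw [sum_add_distrib, ← sum_mul, hsum]
      simp only [sum_const, card_univ, nsmul_eq_mul, mul_inv_cancel₀ h0, zero_mul, sub_zero,
        if_neg hx, pow_add, pow_one]
      ring

/-- A fixed vector of weight `w` lies in the kernel with probability `γ_w ^ M`. -/
lemma sum_matProb_of_mulVec_eq_zero (ε : ℝ) (M : ℕ) {N : ℕ} (x : Fin N → F) :
    (∑ A : Matrix (Fin M) (Fin N) F, if A.mulVec x = 0 then matProb F ε A else 0) =
      gammaW (Fintype.card F) ε #{j | x j ≠ 0} ^ M := by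
  have hrow := sum_prod_muDist_of_dotProduct_eq ε x 0
  rw [if_pos rfl] at hrow
  rw [gammaW, ← hrow, Fintype.sum_pow]
  refine sum_congr rfl fun A _ => ?_
  simp only [matProb, prod_ite_zero, mem_univ, true_imp_iff, funext_iff, Matrix.mulVec,
    Pi.zero_apply]

/-- Summation of a function of the Hamming weight over all nonzero vectors. -/
lemma sum_ne_zero_apply_weight (N : ℕ) (g : ℕ → ℝ) :
    (∑ x : Fin N → F with x ≠ 0, g #{j | x j ≠ 0}) =
      ∑ w ∈ Icc 1 N, (N.choose w : ℝ) * ((Fintype.card F : ℝ) - 1) ^ w * g w := by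
  have hfiber (S : Finset (Fin N)) :
      #{x : Fin N → F | ({j | x j ≠ 0} : Finset (Fin N)) = S} =
        (Fintype.card F - 1) ^ #S := by
    have : ({x : Fin N → F | ({j | x j ≠ 0} : Finset (Fin N)) = S} : Finset (Fin N → F)) =
        Fintype.piFinset fun j => if j ∈ S then univ.erase 0 else {0} := by
      ext x
      simp only [mem_filter, mem_univ, true_and, Finset.ext_iff, Fintype.mem_piFinset]
      refine forall_congr' fun j => ?_
      by_cases hj : j ∈ S <;> simp [hj]
    rw [this, Fintype.card_piFinset]
    simp only [apply_ite Finset.card, card_singleton, card_erase_of_mem (mem_univ _), card_univ]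
    simp
  have hall (h : ℕ → ℝ) : ∑ x : Fin N → F, h #{j | x j ≠ 0} =
      ∑ w ∈ range (N + 1), (N.choose w : ℝ) * ((Fintype.card F : ℝ) - 1) ^ w * h w := by
    rw [← sum_fiberwise' univ (fun x : Fin N → F => ({j | x j ≠ 0} : Finset (Fin N)))
      fun S => h #S]
    simp_rw [sum_const, hfiber, nsmul_eq_mul]
    rw [← powerset_univ,
      sum_powerset_apply_card fun w => (((Fintype.card F - 1) ^ w : ℕ) : ℝ) * h w]
    simp [Nat.cast_sub Fintype.card_pos.nat_succ_le, mul_assoc]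
  have h := hall fun w => if w = 0 then 0 else g w
  rw [range_eq_Ico, sum_eq_sum_Ico_succ_bot N.succ_pos] at h
  simp only [if_true, mul_zero, zero_add] at h
  rw [sum_filter]
  convert h using 1
  · refine sum_congr rfl fun x _ => ?_
    have : #{j | x j ≠ 0} = 0 ↔ x = 0 := by
      simp [filter_eq_empty_iff, funext_iff]
    simp only [this]
    split_ifs <;> simp_all
  · refine sum_congr rfl fun w hw => ?_
    rw [if_neg (Nat.one_le_iff_ne_zero.1 (mem_Icc.1 hw).1)]

/-- A matrix without full column rank kills at least `q - 1` nonzero vectors. -/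
lemma card_sub_one_le_card_ker_ne_zero {M N : ℕ} (A : Matrix (Fin M) (Fin N) F)
    (hA : A.rank < N) :
    (Fintype.card F : ℝ) - 1 ≤ #{x : Fin N → F | x ≠ 0 ∧ A.mulVec x = 0} := by
  have hcard := Fintype.card_pos (α := F)
  obtain ⟨v, hv, hv0⟩ : ∃ v, A.mulVec v = 0 ∧ v ≠ 0 := by
    by_contra! h
    have hinj : Function.Injective A.mulVecLin :=
      (injective_iff_map_eq_zero A.mulVecLin).2 h
    have := LinearMap.finrank_range_of_inj hinj
    rw [Module.finrank_fin_fun] at this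
    exact hA.ne this
  have hle : #(univ.erase (0 : F)) ≤ #{x : Fin N → F | x ≠ 0 ∧ A.mulVec x = 0} := by
    refine card_le_card_of_injOn (fun t => t • v) (fun t ht => ?_) fun s _ t _ hst =>
      smul_left_injective F hv0 hst
    simpa [Matrix.mulVec_smul, hv, hv0] using ht
  rw [card_erase_of_mem (mem_univ _), card_univ] at hle
  have := (Nat.cast_le (α := ℝ)).2 hle
  rwa [Nat.cast_sub hcard.nat_succ_le, Nat.cast_succ, Nat.cast_zero, zero_add] at this

lemma matProb_nonneg {ε : ℝ} (hε : ε ∈ Set.Icc (0 : ℝ) 1) {M N : ℕ}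
    (A : Matrix (Fin M) (Fin N) F) : 0 ≤ matProb F ε A := by
  refine prod_nonneg fun i _ => prod_nonneg fun j _ => ?_
  unfold muDist
  split_ifs
  · exact hε.1
  · exact div_nonneg (sub_nonneg.2 hε.2) (sub_pos.2 one_lt_card_field).le

end RandomRow

/-- for a random `M × N` matrix `A` over `F_q` with i.i.d.
`μ`-distributed entries, the probability that `rank(A) < N` is at most
`μ0(N,M) = (1/(q-1))·Σ_{w=1}^{N} C(N,w)·(q-1)^w·γ_w^M`. -/
theorem stmt_6 (F : Type*) [Field F] [Fintype F] [DecidableEq F]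
    (hq : 2 ≤ Fintype.card F)
    (εSR : ℝ) (hεSR : εSR ∈ Set.Icc (0 : ℝ) 1)
    (M N : ℕ) (hN : 1 ≤ N) :
    (∑ A : Matrix (Fin M) (Fin N) F,
        if A.rank < N then matProb F εSR A else 0) ≤
      mu0 (Fintype.card F : ℝ) εSR N M := by
  have hq' : (0 : ℝ) < (Fintype.card F : ℝ) - 1 := sub_pos.2 one_lt_card_field
  rw [mu0, ← sum_ne_zero_apply_weight N fun w => gammaW (Fintype.card F) εSR w ^ M,
    one_div, inv_mul_eq_div, le_div_iff₀ hq', sum_mul]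
  simp_rw [← sum_matProb_of_mulVec_eq_zero]
  rw [sum_comm]
  refine sum_le_sum fun A _ => ?_
  rw [← sum_filter, filter_filter, sum_const, nsmul_eq_mul, mul_comm]
  have hnonneg := matProb_nonneg hεSR A
  split_ifs with hA
  · exact mul_le_mul_of_nonneg_right (card_sub_one_le_card_ker_ne_zero A hA) hnonneg
  · rw [mul_zero]
    positivity
end
end
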